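/- Let D be a strongly connected digraph on n ≥ 5 vertices with minimum semi-degree at least 2 that satisfies condition (*) and contains no cycle of length n − 1. Let C = x₁x₂…x_m x₁ be a longest non-Hamiltonian cycle of D and let R = V(D) − V(C) satisfy |R| ≥ 3. Suppose y ∈ R is such that x₁y ∈ A(D) and y x_{α+1} ∈ A(D) for some 1 ≤ α ≤ m − 1, and there are no arcs in either direction between y and any of the vertices x₂, …, x_α. Then α ≥ 4. -/

import Mathlib

/-!
Digraphs are modelled as a finite vertex type `V` together with an arc relation
`A : V → V → Prop` (irreflexive, i.e. no loops; no multiple arcs by construction).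
-/

namespace PaperDG

variable {V : Type*}

/-- Out-degree of `v`: the number of out-neighbours. -/
noncomputable def outDeg (A : V → V → Prop) (v : V) : ℕ := Nat.card {w : V // A v w}

/-- In-degree of `v`: the number of in-neighbours. -/
noncomputable def inDeg (A : V → V → Prop) (v : V) : ℕ := Nat.card {w : V // A w v}

/-- Degree `d(v) = d⁺(v) + d⁻(v)`. -/
noncomputable def deg (A : V → V → Prop) (v : V) : ℕ := outDeg A v + inDeg A v

/-- Strong connectivity: every vertex reaches every other by a directed path. -/
def IsStrong (A : V → V → Prop) : Prop := ∀ x y : V, Relation.ReflTransGen A x y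

/-- The digraph has a directed cycle through `k` distinct vertices. -/
def HasCycle (A : V → V → Prop) (k : ℕ) : Prop :=
  ∃ f : ZMod k → V, Function.Injective f ∧ ∀ i : ZMod k, A (f i) (f (i + 1))

/-- Condition (*): `d(x) + d(y) ≥ 2n - 1` and `min {d(x), d(y)} ≥ n - 1` for every pair of
non-adjacent vertices `x, y` with a common in-neighbour. -/
def CondStar [Fintype V] (A : V → V → Prop) : Prop :=
  ∀ x y : V, x ≠ y → ¬A x y → ¬A y x → (∃ u : V, A u x ∧ A u y) →
    2 * Fintype.card V - 1 ≤ deg A x + deg A y ∧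
      Fintype.card V - 1 ≤ min (deg A x) (deg A y)

/-- Condition (**): `min {d⁺(x) + d⁻(y), d⁻(x) + d⁺(y)} ≥ n` for every pair of non-adjacent
vertices `x, y` with a common in-neighbour or a common out-neighbour. -/
def CondStarStar [Fintype V] (A : V → V → Prop) : Prop :=
  ∀ x y : V, x ≠ y → ¬A x y → ¬A y x →
    ((∃ u : V, A u x ∧ A u y) ∨ (∃ u : V, A x u ∧ A y u)) →
    Fintype.card V ≤ min (outDeg A x + inDeg A y) (inDeg A x + outDeg A y)

/-- The digraph is (isomorphic to) the complete bipartite digraph `K*_{n/2,n/2}`: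
there is a part `S` of size `n/2` such that the arcs are exactly the pairs of vertices
lying in different parts. -/
def IsKhalf [Fintype V] (A : V → V → Prop) : Prop :=
  ∃ S : Set V, 2 * Nat.card S = Fintype.card V ∧
    ∀ x y : V, A x y ↔ (x ∈ S ↔ y ∉ S)

/-- The digraph is (isomorphic to) `K*_{n/2,n/2}` minus one arc. -/
def IsKhalfMinusArc [Fintype V] (A : V → V → Prop) : Prop :=
  ∃ S : Set V, ∃ a b : V, 2 * Nat.card S = Fintype.card V ∧ (a ∈ S ↔ b ∉ S) ∧
    ∀ x y : V, A x y ↔ ((x ∈ S ↔ y ∉ S) ∧ ¬(x = a ∧ y = b))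

/-- Minimum semi-degree at least `k`. -/
def MinSemiDegreeGE (A : V → V → Prop) (k : ℕ) : Prop :=
  ∀ v : V, k ≤ outDeg A v ∧ k ≤ inDeg A v

/-- Locally semicomplete: for every vertex `x` the out-neighbourhood and the
in-neighbourhood of `x` both induce semicomplete digraphs. -/
def LocallySemicomplete (A : V → V → Prop) : Prop :=
  ∀ x u v : V, u ≠ v →
    ((A x u → A x v → A u v ∨ A v u) ∧ (A u x → A v x → A u v ∨ A v u))

end PaperDG

open PaperDG


namespace DKproof

open Classical in
noncomputable def e {V : Type*} (A : V → V → Prop) (v w : V) : ℕ :=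
  (if A v w then 1 else 0) + (if A w v then 1 else 0)

theorem deg_eq {V : Type*} [Fintype V] (A : V → V → Prop) (v : V) :
    deg A v = ∑ w, e A v w := by
  classical
  unfold deg outDeg inDeg e
  rw [Finset.sum_add_distrib]
  simp [Nat.card_eq_fintype_card, Fintype.card_subtype]

theorem cyc_of_list {V : Type*} (A : V → V → Prop) (h : V) (T : List V)
    (hnd : (h :: T).Nodup) (hc : List.IsChain A (h :: T ++ [h])) :
    HasCycle A (T.length + 1) := by
  have hlt : ∀ i : ZMod (T.length + 1), i.val < (h :: T).length := by
    intro i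
    simpa using ZMod.val_lt i
  refine ⟨fun i => (h :: T)[i.val]'(hlt i), ?_, ?_⟩
  · intro i j hij
    have := (List.Nodup.getElem_inj_iff hnd).1 hij
    exact ZMod.val_injective _ this
  · intro i
    rw [List.isChain_iff_getElem] at hc
    have h1 := hlt i
    have h2 := hc i.val (by simp at h1 ⊢; omega)
    have e1 : (h :: T ++ [h])[i.val]'(by simp at h1 ⊢; omega) = (h :: T)[i.val]'h1 := by
      rw [List.getElem_append_left]
    rw [e1] at h2
    convert h2 using 1
    by_cases hi : i.val = T.length
    · have : i + 1 = 0 := by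
        have h3 : ((i.val : ℕ) : ZMod (T.length + 1)) = i := ZMod.natCast_zmod_val i
        rw [← h3, hi]
        exact_mod_cast ZMod.natCast_self (T.length + 1)
      have h0 : (i+1).val = 0 := by rw [this]; exact ZMod.val_zero
      simp only [h0, hi]
      simp
    · have h3 : (i + 1).val = i.val + 1 := by
        have h4 : ((i.val : ℕ) : ZMod (T.length + 1)) = i := ZMod.natCast_zmod_val i
        have h5 : i + 1 = ((i.val + 1 : ℕ) : ZMod (T.length + 1)) := by push_cast; rw [h4]
        rw [h5, ZMod.val_natCast]
        apply Nat.mod_eq_of_lt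
        simp at h1; omega
      simp only [h3]
      simp at h1
      rw [List.getElem_append_left (by simp; omega)]

open Classical in
theorem cnt_le {V : Type*} (A : V → V → Prop) (v : V) : ∀ (P : List V) (h l : V),
    P.head? = some h → P.getLast? = some l →
    (∀ s a b t, P = s ++ a :: b :: t → A a v → A v b → False) →
    (P.map (e A v)).sum + 1 ≤ P.length + (if A v h then 1 else 0) + (if A l v then 1 else 0) := by
  intro P
  induction P with
  | nil => intro h l hh; simp at hh
  | cons a P ih =>
    intro h l hh hl hins
    cases P with
    | nil =>
      simp at hh hl
      subst hh hl
      simp [e]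
    | cons b t =>
      have := ih b l (by simp) (by simpa using hl)
        (fun s a' b' t' hs => hins (a :: s) a' b' t' (by simp [hs]))
      have h2 := hins [] a b t rfl
      simp at hh
      subst hh
      simp only [List.map_cons, List.sum_cons, List.length_cons] at this ⊢
      have h3 : e A v a = (if A v a then 1 else 0) + (if A a v then 1 else 0) := rfl
      have h4 : (if A a v then 1 else 0) + (if A v b then 1 else 0) ≤ 1 := by
        split_ifs <;> first | omega | exact (h2 ‹_› ‹_›).elim
      omega

theorem two_deg {V : Type*} [Fintype V] (A : V → V → Prop) (hirr : ∀ v : V, ¬A v v)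
    (u v : V) (Q : List V) (hnd : (Q ++ [u, v]).Nodup)
    (h1 : ¬ A u v) (h2 : ¬ A v u)
    (hz : ∀ z, z ∉ Q → z ≠ u → z ≠ v → ¬ (A u z ∧ A z v) ∧ ¬ (A v z ∧ A z u)) :
    deg A u + deg A v + 2 * (Q.length + 2) ≤
      (Q.map (e A u)).sum + (Q.map (e A v)).sum + 2 * Fintype.card V := by
  classical
  have hs : ∀ w, deg A w = ((Q ++ [u,v]).map (e A w)).sum +
      ∑ z ∈ (Q ++ [u,v]).toFinsetᶜ, e A w z := by
    intro w
    rw [deg_eq, ← List.sum_toFinset _ hnd, Finset.sum_add_sum_compl]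
  have hle : ∑ z ∈ (Q ++ [u,v]).toFinsetᶜ, e A u z + ∑ z ∈ (Q ++ [u,v]).toFinsetᶜ, e A v z
      ≤ (Q ++ [u,v]).toFinsetᶜ.card * 2 := by
    rw [← Finset.sum_add_distrib]
    apply Finset.sum_le_card_nsmul
    intro z hzz
    simp at hzz
    obtain ⟨a, b⟩ := hz z (by tauto) (by tauto) (by tauto)
    unfold e
    split_ifs <;> first | omega | tauto
  have hcard : (Q ++ [u,v]).toFinsetᶜ.card + (Q.length + 2) = Fintype.card V := by
    have := Finset.card_compl_add_card (Q ++ [u,v]).toFinset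
    rw [List.toFinset_card_of_nodup hnd] at this
    simpa using this
  have a1 := hs u
  have a2 := hs v
  simp [e, h1, h2, hirr] at a1 a2
  simp only [e] at *
  simp at hle hcard ⊢
  omega

structure Pth {V : Type*} (A : V → V → Prop) (h l : V) (P : List V) : Prop where
  nd : P.Nodup
  ch : List.IsChain A P
  hd : P.head? = some h
  lt : P.getLast? = some l

theorem Pth.cyc {V : Type*} {A : V → V → Prop} {h l : V} {P : List V} (hP : Pth A h l P)
    (K : List V) (hnd : (P ++ K).Nodup) (hc : List.IsChain A (l :: K ++ [h])) :
    HasCycle A (P.length + K.length) := by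
  obtain ⟨_, ch, hd, lt⟩ := hP
  cases P with
  | nil => simp at hd
  | cons a T =>
    simp at hd
    subst hd
    have := cyc_of_list A a (T ++ K) (by simpa using hnd) (by
      have : a :: (T ++ K) ++ [a] = (a :: T) ++ (K ++ [a]) := by simp
      rw [this, List.isChain_append]
      have hc' : List.IsChain A ([l] ++ (K ++ [a])) := by simpa using hc
      rw [List.isChain_append] at hc'
      refine ⟨ch, hc'.2.1, ?_⟩
      intro x hx y hy
      rw [lt] at hx
      exact hc'.2.2 x (by simpa using hx) y hy)
    convert this using 1
    simp; omega

theorem Pth.ins {V : Type*} {A : V → V → Prop} {h l v : V} {s t : List V} {a b : V}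
    (hP : Pth A h l (s ++ a :: b :: t)) (hv : v ∉ s ++ a :: b :: t)
    (h1 : A a v) (h2 : A v b) : Pth A h l (s ++ a :: v :: b :: t) := by
  obtain ⟨nd, ch, hd, lt⟩ := hP
  refine ⟨?_, ?_, ?_, ?_⟩
  · have : (s ++ a :: v :: b :: t).Perm (v :: (s ++ a :: b :: t)) := by
      have := List.perm_middle (a := v) (l₁ := s ++ [a]) (l₂ := b :: t)
      simpa using this
    rw [this.nodup_iff]
    exact List.nodup_cons.2 ⟨hv, nd⟩
  · simp only [List.isChain_append, List.isChain_cons_cons] at ch ⊢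
    refine ⟨ch.1, ⟨h1, h2, ch.2.1.2⟩, ?_⟩
    simpa using ch.2.2
  · cases s <;> simpa using hd
  · simpa using lt

theorem perm_ins {V : Type*} {v : V} {s t : List V} {a b : V} :
    (s ++ a :: v :: b :: t).Perm (v :: (s ++ a :: b :: t)) := by
  have := List.perm_middle (a := v) (l₁ := s ++ [a]) (l₂ := b :: t)
  simpa using this

theorem exists_last {V : Type*} (p : V → Prop) : ∀ (Q : List V) (l : V), Q.getLast? = some l →
    ¬ p l → (∃ q ∈ Q, p q) → ∃ s a b t, Q = s ++ a :: b :: t ∧ p a ∧ ¬ p b := by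
  intro Q
  induction Q with
  | nil => intro l h; simp at h
  | cons c Q ih =>
    intro l hl hpl hex
    cases Q with
    | nil => simp at hl hex; subst hl; exact absurd hex hpl
    | cons d t =>
      by_cases hq : ∃ q ∈ d :: t, p q
      · obtain ⟨s, a, b, t', h, h'⟩ := ih l (by simpa using hl) hpl hq
        exact ⟨c :: s, a, b, t', by simp [h], h'⟩
      · refine ⟨[], c, d, t, rfl, ?_, ?_⟩
        · obtain ⟨q, hq1, hq2⟩ := hex
          rcases List.mem_cons.1 hq1 with rfl | h
          · exact hq2
          · exact absurd ⟨q, h, hq2⟩ hq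
        · intro h; exact hq ⟨d, by simp, h⟩

theorem case2 {V : Type*} [Fintype V] (A : V → V → Prop) (hirr : ∀ v : V, ¬A v v)
    (hstar : CondStar A) (m : ℕ)
    (hlongest : ∀ k : ℕ, k < Fintype.card V → HasCycle A k → k ≤ m)
    (hR : m + 3 ≤ Fintype.card V) (h l y v : V) (P : List V) (hP : Pth A h l P)
    (hlen : P.length + 1 = m) (hnd : (P ++ [y, v]).Nodup)
    (ly : A l y) (yh : A y h) (lv : A l v) (vh : A v h) (h1 : ¬ A y v) (h2 : ¬ A v y) : False := by
  have hnd' := hnd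
  simp [List.nodup_append] at hnd'
  have hvP : v ∉ P := fun hh => (hnd'.2.2 v hh).2 rfl
  have hyP : y ∉ P := fun hh => (hnd'.2.2 y hh).1 rfl
  have hc : ∀ u w, u ∉ P → w ∉ P → u ≠ w → A l u → A u h →
      (P.map (e A w)).sum ≤ m := by
    intro u w hu hw huw lu uh
    have := cnt_le A w P h l hP.hd hP.lt (by
      rintro s a b t rfl haw hwb
      have := (hP.ins hw haw hwb).cyc [u] (by
          rw [(perm_ins.append_right [u]).nodup_iff]
          simp only [List.cons_append, List.nodup_cons]
          refine ⟨?_, ?_⟩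
          · simp at hw ⊢; grind
          · have := hP.nd
            rw [List.nodup_append]; refine ⟨this, by simp, ?_⟩
            rintro c hc d hd rfl
            simp at hd; subst hd; exact hu hc) (by simp [lu, uh])
      have := hlongest _ (by simp at hlen ⊢; omega) this
      simp at hlen this; omega)
    split_ifs at this <;> omega
  have c1 := hc y v hyP hvP (by grind) ly yh
  have c2 := hc v y hvP hyP (by grind) lv vh
  have hz : ∀ u w, u ∉ P → w ∉ P → u ≠ w → A l u → A w h → ∀ z, z ∉ P → z ≠ u → z ≠ w →
      ¬ (A u z ∧ A z w) := by
    rintro u w hu hw huw lu wh z hzP hzu hzw ⟨h3, h4⟩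
    have := hP.cyc [u, z, w] (by
      rw [List.nodup_append]; refine ⟨hP.nd, by simp; grind, ?_⟩
      rintro c hc d hd rfl
      simp at hd; grind) (by simp [*])
    have := hlongest _ (by simp at hlen ⊢; omega) this
    simp at this; omega
  have := two_deg A hirr y v P hnd h1 h2 (fun z z1 z2 z3 =>
    ⟨hz y v hyP hvP (by grind) ly vh z z1 z2 z3, hz v y hvP hyP (by grind) lv yh z z1 z3 z2⟩)
  have h5 := (hstar y v (by grind) h1 h2 ⟨l, ly, lv⟩).1
  omega

theorem case3 {V : Type*} [Fintype V] (A : V → V → Prop) (hirr : ∀ v : V, ¬A v v)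
    (hstar : CondStar A) (m : ℕ)
    (hlongest : ∀ k : ℕ, k < Fintype.card V → HasCycle A k → k ≤ m)
    (hR : m + 3 ≤ Fintype.card V) (h l y v w : V) (P : List V) (hP : Pth A h l P)
    (hlen : P.length + 2 = m) (hyP : y ∉ P) (hvP : v ∉ P) (hwP : w ∉ P)
    (yv : y ≠ v) (yw : y ≠ w) (hvw : v ≠ w)
    (ly : A l y) (yh : A y h) (lv : A l v) (vw : A v w) (wh : A w h)
    (h1 : ¬ A y v) (h2 : ¬ A v y) (h3 : ¬ A y w) (h4 : ¬ A w y) : False := by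
  have cyc : ∀ Q K, Pth A h l Q → m < Q.length + K.length → Q.length + K.length ≤ m + 2 →
      (Q ++ K).Nodup → List.IsChain A (l :: K ++ [h]) → False := by
    intro Q K hQ a1 a2 hnd hch
    have := hlongest _ (by omega) (hQ.cyc K hnd hch)
    omega
  have napp : ∀ Q K, Pth A h l Q → K.Nodup → (∀ k ∈ K, k ∉ Q) → (Q ++ K).Nodup := by
    intro Q K hQ hK hd
    rw [List.nodup_append]
    refine ⟨hQ.nd, hK, ?_⟩
    rintro c hc d hd' rfl
    exact hd c hd' hc
  have hd1 := hstar y v yv h1 h2 ⟨l, ly, lv⟩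
  have cy : (P.map (e A y)).sum ≤ m - 1 := by
    have := cnt_le A y P h l hP.hd hP.lt (by
      rintro s a b t rfl haw hwb
      refine cyc _ [v, w] (hP.ins hyP haw hwb) (by simp at hlen ⊢; omega)
        (by simp at hlen ⊢; omega) ?_ (by simp [*])
      apply napp _ _ (hP.ins hyP haw hwb) (by simp [hvw])
      intro k hk
      rw [perm_ins.mem_iff]
      simp only [List.mem_cons, List.not_mem_nil, or_false] at hk
      rcases hk with rfl | rfl
      · exact fun hh => (List.mem_cons.1 hh).elim (fun q => yv q.symm) hvP
      · exact fun hh => (List.mem_cons.1 hh).elim (fun q => yw q.symm) hwP)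
    split_ifs at this <;> omega
  have eyv : e A y v = 0 := by simp [e, *]
  have eyw : e A y w = 0 := by simp [e, *]
  have hle2 : ∀ a b, e A a b ≤ 2 := by intro a b; unfold e; split_ifs <;> omega
  -- v is insertable
  have hins : ∃ s a b t, P = s ++ a :: b :: t ∧ A a v ∧ A v b := by
    by_contra hcon
    have cv := cnt_le A v P h l hP.hd hP.lt (by
      intro s a b t hs x1 x2; exact hcon ⟨s, a, b, t, hs, x1, x2⟩)
    have := two_deg A hirr y v (w :: P) (by
        have := napp P [w, y, v] hP (by simp; grind) (by simp [*])
        refine (List.Perm.nodup_iff ?_).1 this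
        have := List.perm_middle (a := w) (l₁ := P) (l₂ := [y, v])
        simpa using this) h1 h2 (by
      intro z z1 z2 z3
      simp only [List.mem_cons, not_or] at z1
      constructor
      · rintro ⟨p, q⟩
        exact cyc P [y, z, v, w] hP (by simp; omega) (by simp; omega)
          (napp _ _ hP (by simp; grind) (by simp [*])) (by simp [*])
      · rintro ⟨p, q⟩
        exact cyc P [v, z, y] hP (by simp; omega) (by simp; omega)
          (napp _ _ hP (by simp; grind) (by simp [*])) (by simp [*]))
    have := hle2 v w
    simp only [List.map_cons, List.sum_cons, List.length_cons] at *
    have := hd1.1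
    split_ifs at cv <;> omega
  obtain ⟨s, a, b, t, rfl, hav, hvb⟩ := hins
  have hQ := hP.ins hvP hav hvb
  have hQm : ∀ k, k ∈ s ++ a :: v :: b :: t ↔ k = v ∨ k ∈ s ++ a :: b :: t := by
    intro k; rw [perm_ins.mem_iff, List.mem_cons]
  have hQl : (s ++ a :: v :: b :: t).length + 1 = m := by simp at hlen ⊢; omega
  have cyQ : ((s ++ a :: v :: b :: t).map (e A y)).sum ≤ m - 1 := by
    rw [(perm_ins.map (e A y)).sum_eq, List.map_cons, List.sum_cons, eyv]
    omega
  have hwQ : w ∉ s ++ a :: v :: b :: t := by rw [hQm]; grind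
  have hyQ : y ∉ s ++ a :: v :: b :: t := by rw [hQm]; grind
  have hvP' := hvP
  generalize hQQ : s ++ a :: v :: b :: t = Q at *
  have hvQ : v ∈ Q := by rw [hQm]; simp
  have nins : ∀ s a b t, Q = s ++ a :: b :: t → A a w → A w b → False := by
    rintro s a b t rfl haw hwb
    refine cyc _ [y] (hQ.ins hwQ haw hwb) (by simp at hQl ⊢; omega)
      (by simp at hQl ⊢; omega) ?_ (by simp [*])
    apply napp _ _ (hQ.ins hwQ haw hwb) (by simp)
    intro k hk
    rw [perm_ins.mem_iff]
    simp only [List.mem_cons, List.not_mem_nil, or_false] at hk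
    subst hk
    exact fun hh => (List.mem_cons.1 hh).elim yw hyQ
  have cw := cnt_le A w Q h l hQ.hd hQ.lt nins
  have hsum := two_deg A hirr y w Q (napp _ _ hQ (by simp [yw]) (by simp [hyQ, hwQ])) h3 h4 (by
      intro z z1 z2 z3
      constructor
      · rintro ⟨p, q⟩
        exact cyc Q [y, z, w] hQ (by simp; omega) (by simp; omega)
          (napp _ _ hQ (by simp; grind) (by simp [hyQ, hwQ, z1])) (by simp [*])
      · rintro ⟨p, q⟩
        have zv : z ≠ v := by rintro rfl; exact z1 hvQ
        have zP : z ∉ s ++ a :: b :: t := fun hh => z1 ((hQm z).2 (Or.inr hh))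
        refine cyc _ [v, w, z, y] hP (by simp at hlen ⊢; omega) (by simp at hlen ⊢; omega)
          (napp _ _ hP (by simp; grind) ?_) (by simp [*])
        intro k hk
        simp only [List.mem_cons, List.not_mem_nil, or_false] at hk
        rcases hk with rfl | rfl | rfl | rfl <;> assumption)
  have hlw : ¬ A l w := by
    intro hlw
    have := (hstar y w yw h3 h4 ⟨l, ly, hlw⟩).1
    split_ifs at cw <;> omega
  obtain ⟨s', c, d, t', hs', hc, hd⟩ := exists_last (fun q => A q w) Q l hQ.lt hlw ⟨v, hvQ, vw⟩
  have hwd : ¬ A w d := fun hh => nins s' c d t' hs' hc hh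
  have hcd : A c d := by
    have := hQ.ch
    rw [hs', List.isChain_append, List.isChain_cons_cons] at this
    exact this.2.1.1
  have hne : w ≠ d := by
    rintro rfl; apply hwQ; rw [hs']; simp
  have := (hstar w d hne hwd hd ⟨c, hc, hcd⟩).2
  have h7 := hd1.2
  rw [le_min_iff] at this h7
  simp only [hlw, if_false] at cw
  split_ifs at cw <;> omega

end DKproof

/-- Claim 1 of Theorem 1.  The cycle `C = x₁x₂…x_m x₁` is encoded by an
`m`-periodic map `x : ℕ → V` injective on `[0, m)` (so `x_i` is `x i`, with
`x m = x 0`, i.e. `x_m = x 0` under the labelling `x₁, …, x_m`). -/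
theorem darbinyan_karapetyan_claim1 {V : Type*} [Fintype V] (A : V → V → Prop)
    (hirr : ∀ v : V, ¬A v v)
    (hn : 5 ≤ Fintype.card V)
    (hstrong : IsStrong A)
    (hsemi : MinSemiDegreeGE A 2)
    (hstar : CondStar A)
    (hnoCn1 : ¬HasCycle A (Fintype.card V - 1))
    (m : ℕ) (hm2 : 2 ≤ m)
    (x : ℕ → V)
    (hper : ∀ i : ℕ, x (i + m) = x i)
    (hinjC : ∀ i j : ℕ, i < m → j < m → x i = x j → i = j)
    (hcyc : ∀ i : ℕ, A (x i) (x (i + 1)))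
    -- `C` is a longest non-Hamiltonian cycle:
    (hshort : m < Fintype.card V)
    (hlongest : ∀ k : ℕ, k < Fintype.card V → HasCycle A k → k ≤ m)
    -- `|R| ≥ 3`:
    (hR : m + 3 ≤ Fintype.card V)
    (y : V) (hy : ∀ i : ℕ, y ≠ x i)
    (α : ℕ) (hα1 : 1 ≤ α) (hα2 : α ≤ m - 1)
    (h1 : A (x 1) y) (h2 : A y (x (α + 1)))
    (hgap : ∀ j : ℕ, 2 ≤ j → j ≤ α → ¬A y (x j) ∧ ¬A (x j) y) :
    4 ≤ α := by
  by_contra hlt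
  have hmod : ∀ i, x i = x (i % m) := fun i =>
    (Function.Periodic.map_mod_nat (f := x) (a := m) hper i).symm
  have inj : ∀ i j, i < j → j < i + m → x i ≠ x j := by
    intro i j hij hj he
    rw [hmod i, hmod j] at he
    have := hinjC _ _ (Nat.mod_lt _ (by omega)) (Nat.mod_lt _ (by omega)) he
    have h3 : m ∣ j - i := (Nat.modEq_iff_dvd' hij.le).1 this
    have := Nat.le_of_dvd (by omega) h3
    omega
  have x1 : x (m + 1) = x 1 := by rw [add_comm]; exact hper 1
  obtain ⟨P, hPdef⟩ : ∃ P, P = (List.range (m - α + 1)).map (fun i => x (α + 1 + i)) := ⟨_, rfl⟩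
  have hlen : P.length = m - α + 1 := by simp [hPdef]
  have hP : DKproof.Pth A (x (α + 1)) (x 1) P := by
    refine ⟨?_, ?_, ?_, ?_⟩
    · rw [hPdef]
      apply List.Nodup.map_on _ List.nodup_range
      intro i hi j hj hij
      simp only [List.mem_range] at hi hj
      by_contra hne
      rcases Nat.lt_or_gt_of_ne hne with h | h
      · exact inj _ _ (by omega) (by omega) hij
      · exact inj _ _ (by omega) (by omega) hij.symm
    · rw [hPdef, List.isChain_iff_getElem]
      intro i hi
      simp only [List.getElem_map, List.getElem_range]
      exact hcyc _
    · rw [hPdef, List.range_succ_eq_map]; simp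
    · rw [hPdef, List.range_succ]
      simp
      rw [← x1]; congr 1; omega
  have hyP : y ∉ P := by
    rw [hPdef]; simp only [List.mem_map, not_exists, not_and]
    intro i _ h; exact hy _ h.symm
  have hxP : ∀ j, 2 ≤ j → j ≤ α → x j ∉ P := by
    intro j hj hj'
    rw [hPdef]; simp only [List.mem_map, not_exists, not_and, List.mem_range]
    intro i hi h; exact inj j (α + 1 + i) (by omega) (by omega) h.symm
  have hα : α = 1 ∨ α = 2 ∨ α = 3 := by omega
  rcases hα with rfl | rfl | rfl
  · have := hP.cyc [y] (by simp [List.nodup_append, hP.nd]; rintro a ha rfl; exact hyP ha)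
      (by simp [h1, h2])
    have := hlongest _ (by simp; omega) this
    simp at this; omega
  · refine DKproof.case2 A hirr hstar m hlongest hR _ _ y (x 2) P hP (by omega) ?_ h1 h2
      (hcyc 1) (hcyc 2) (hgap 2 le_rfl le_rfl).1 (hgap 2 le_rfl le_rfl).2
    have := hxP 2 le_rfl le_rfl
    rw [List.nodup_append]
    refine ⟨hP.nd, by simp [hy], ?_⟩
    rintro c hc d hd rfl
    simp at hd
    rcases hd with rfl | rfl <;> contradiction
  · exact DKproof.case3 A hirr hstar m hlongest hR _ _ y (x 2) (x 3) P hP (by omega) hyP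
      (hxP 2 (by omega) (by omega)) (hxP 3 (by omega) (by omega)) (hy 2) (hy 3)
      (inj 2 3 (by omega) (by omega)) h1 h2 (hcyc 1) (hcyc 2) (hcyc 3)
      (hgap 2 (by omega) (by omega)).1 (hgap 2 (by omega) (by omega)).2
      (hgap 3 (by omega) (by omega)).1 (hgap 3 (by omega) (by omega)).2
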